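/- arXiv:1904.04044 — 7 statements merged into one kernel-verified Lean document; each statement's English description precedes it below -/
import Mathlib

section
/- Monotonicity with respect to injections: Let V and W be persistence modules with V ≅ ⊕_{I∈B} 𝔽(I) and W ≅ ⊕_{J∈C} 𝔽(J) for finite multisets of intervals B and C. If there exists a morphism ι : V → W such that ι_t is injective for every t ∈ ℝ, then for every b ∈ ℝ and every d with b < d ≤ +∞, the number (counted with multiplicity) of bars (a,d] ∈ B with a ≤ b is at most the number of bars (a,d] ∈ C with a ≤ b. -/
open Classical

noncomputable section

/-- A persistence module over a field `𝔽`: a family of finite-dimensional vector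
spaces indexed by `ℝ` together with transition maps satisfying the persistence laws. -/
structure PersistenceModule (𝔽 : Type) [Field 𝔽] where
  V : ℝ → Type
  [grp : ∀ t, AddCommGroup (V t)]
  [mod : ∀ t, Module 𝔽 (V t)]
  [fin : ∀ t, FiniteDimensional 𝔽 (V t)]
  π : ∀ s t : ℝ, s ≤ t → (V s →ₗ[𝔽] V t)
  π_refl : ∀ t : ℝ, π t t le_rfl = LinearMap.id
  π_comp : ∀ (s t r : ℝ) (hst : s ≤ t) (htr : t ≤ r),
    (π t r htr).comp (π s t hst) = π s r (hst.trans htr)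

attribute [instance] PersistenceModule.grp PersistenceModule.mod PersistenceModule.fin

namespace PersistenceModule

variable {𝔽 : Type} [Field 𝔽]

/-- The regularity ("finite type", semicontinuity and lower-boundedness) axioms of a
persistence module: away from a finite set, transition maps are locally isomorphisms;
the module is semicontinuous from the left; and it vanishes for `s` sufficiently small. -/
def IsRegular (M : PersistenceModule 𝔽) : Prop :=
  (∃ S : Finset ℝ, ∀ t : ℝ, t ∉ S → ∃ U ∈ nhds t,
    ∀ s ∈ U, ∀ r ∈ U, ∀ h : s ≤ r, Function.Bijective (M.π s r h)) ∧
  (∀ t : ℝ, ∃ ε : ℝ, 0 < ε ∧ ∀ s : ℝ, t - ε < s → ∀ h : s ≤ t, Function.Bijective (M.π s t h)) ∧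
  (∃ s₀ : ℝ, ∀ s : ℝ, s ≤ s₀ → ∀ x : M.V s, x = 0)

/-- A morphism of persistence modules. -/
structure Hom (M N : PersistenceModule 𝔽) where
  A : ∀ t : ℝ, M.V t →ₗ[𝔽] N.V t
  comm : ∀ (s t : ℝ) (h : s ≤ t), (A t).comp (M.π s t h) = (N.π s t h).comp (A s)

/-- Two persistence modules are isomorphic if there are mutually inverse morphisms. -/
def Iso (M N : PersistenceModule 𝔽) : Prop :=
  ∃ (f : Hom M N) (g : Hom N M),
    (∀ (t : ℝ) (x : M.V t), g.A t (f.A t x) = x) ∧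
    (∀ (t : ℝ) (y : N.V t), f.A t (g.A t y) = y)

/-- `δ`-interleaving of two persistence modules, stated pointwise (`F, G` are the
interleaving morphisms `V → W[δ]`, `W → V[δ]`, and the two triangles express that the
compositions are the `2δ`-shift morphisms). -/
def Interleaved (M N : PersistenceModule 𝔽) (δ : ℝ) : Prop :=
  ∃ (F : ∀ t : ℝ, M.V t →ₗ[𝔽] N.V (t + δ)) (G : ∀ t : ℝ, N.V t →ₗ[𝔽] M.V (t + δ)),
    (∀ (s t : ℝ) (h : s ≤ t),
      (F t).comp (M.π s t h) = (N.π (s + δ) (t + δ) (by linarith)).comp (F s)) ∧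
    (∀ (s t : ℝ) (h : s ≤ t),
      (G t).comp (N.π s t h) = (M.π (s + δ) (t + δ) (by linarith)).comp (G s)) ∧
    (∀ (t : ℝ) (h : t ≤ t + δ + δ),
      (G (t + δ)).comp (F t) = M.π t (t + δ + δ) h) ∧
    (∀ (t : ℝ) (h : t ≤ t + δ + δ),
      (F (t + δ)).comp (G t) = N.π t (t + δ + δ) h)

/-- Interleaving distance, with value in `EReal` (`+∞` if no interleaving exists). -/
def dInt (M N : PersistenceModule 𝔽) : EReal :=
  sInf {x : EReal | ∃ δ : ℝ, 0 < δ ∧ x = (δ : EReal) ∧ Interleaved M N δ}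

/-- The persistence submodule of `(-1)`-eigenspaces of an endomorphism `A` of `M`. -/
def negEigen (M : PersistenceModule 𝔽) (A : Hom M M) : PersistenceModule 𝔽 where
  V t := ↥(LinearMap.ker (A.A t + (LinearMap.id : M.V t →ₗ[𝔽] M.V t)))
  π s t h := LinearMap.restrict (M.π s t h) (by
    intro x hx
    have hc := congrArg (fun f : M.V s →ₗ[𝔽] M.V t => f x) (A.comm s t h)
    simp only [LinearMap.comp_apply] at hc
    simp only [LinearMap.mem_ker, LinearMap.add_apply, LinearMap.id_apply] at hx ⊢
    rw [hc, ← map_add (M.π s t h), hx, map_zero])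
  π_refl t := by
    apply LinearMap.ext
    intro x
    apply Subtype.ext
    have := congrArg (fun f : M.V t →ₗ[𝔽] M.V t => f (x : M.V t)) (M.π_refl t)
    simpa [LinearMap.restrict_apply] using this
  π_comp s t r hst htr := by
    apply LinearMap.ext
    intro x
    apply Subtype.ext
    have := congrArg (fun f : M.V s →ₗ[𝔽] M.V r => f (x : M.V s)) (M.π_comp s t r hst htr)
    simpa [LinearMap.restrict_apply] using this

/-- `(δ, ℤ₂)`-equivariant interleaving of two persistence modules with involutions
`AM` and `AN`. -/
def Z2Interleaved (M N : PersistenceModule 𝔽) (AM : Hom M M) (AN : Hom N N) (δ : ℝ) : Prop :=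
  ∃ (F : ∀ t : ℝ, M.V t →ₗ[𝔽] N.V (t + δ)) (G : ∀ t : ℝ, N.V t →ₗ[𝔽] M.V (t + δ)),
    (∀ (s t : ℝ) (h : s ≤ t),
      (F t).comp (M.π s t h) = (N.π (s + δ) (t + δ) (by linarith)).comp (F s)) ∧
    (∀ (s t : ℝ) (h : s ≤ t),
      (G t).comp (N.π s t h) = (M.π (s + δ) (t + δ) (by linarith)).comp (G s)) ∧
    (∀ (t : ℝ) (h : t ≤ t + δ + δ),
      (G (t + δ)).comp (F t) = M.π t (t + δ + δ) h) ∧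
    (∀ (t : ℝ) (h : t ≤ t + δ + δ),
      (F (t + δ)).comp (G t) = N.π t (t + δ + δ) h) ∧
    (∀ t : ℝ, (F t).comp (AM.A t) = (AN.A (t + δ)).comp (F t)) ∧
    (∀ t : ℝ, (G t).comp (AN.A t) = (AM.A (t + δ)).comp (G t))

/-- The `ℤ₂`-interleaving distance, with value in `EReal`. -/
def dZ2Int (M N : PersistenceModule 𝔽) (AM : Hom M M) (AN : Hom N N) : EReal :=
  sInf {x : EReal | ∃ δ : ℝ, 0 < δ ∧ x = (δ : EReal) ∧ Z2Interleaved M N AM AN δ}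

end PersistenceModule

/-- A bar `(a, b]` is recorded as the pair of its left endpoint `a ∈ ℝ`
and its right endpoint `b ∈ ℝ ∪ {±∞}`. -/
abbrev Bar := ℝ × EReal

/-- A bar is valid if `a < b` (so it encodes a nonempty interval `(a,b]`, `b ≤ +∞`). -/
def Bar.valid (I : Bar) : Prop := (I.1 : EReal) < I.2

/-- Membership `t ∈ (a, b]`. -/
def Bar.has (I : Bar) (t : ℝ) : Prop := I.1 < t ∧ (t : EReal) ≤ I.2

/-- The fiber at `t` of the interval module of `I`, as a submodule of `𝔽`. -/
def barSub (𝔽 : Type) [Field 𝔽] (I : Bar) (t : ℝ) : Submodule 𝔽 𝔽 :=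
  if Bar.has I t then ⊤ else ⊥

lemma barSub_coe_zero {𝔽 : Type} [Field 𝔽] {I : Bar} {t : ℝ}
    (hm : ¬ Bar.has I t) (x : barSub 𝔽 I t) : (x : 𝔽) = 0 := by
  have hx := x.2
  simp only [barSub, if_neg hm, Submodule.mem_bot] at hx
  exact hx

/-- The transition maps of an interval module. -/
def barMap (𝔽 : Type) [Field 𝔽] (I : Bar) (s t : ℝ) :
    barSub 𝔽 I s →ₗ[𝔽] barSub 𝔽 I t where
  toFun x := ⟨if Bar.has I t then (x : 𝔽) else 0, by
    split_ifs with hm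
    · simp [barSub, hm]
    · exact (barSub 𝔽 I t).zero_mem⟩
  map_add' x y := by
    apply Subtype.ext
    by_cases hm : Bar.has I t <;> simp [hm]
  map_smul' c x := by
    apply Subtype.ext
    by_cases hm : Bar.has I t <;> simp [hm]

lemma barMap_coe (𝔽 : Type) [Field 𝔽] (I : Bar) (s t : ℝ) (x : barSub 𝔽 I s) :
    (barMap 𝔽 I s t x : 𝔽) = if Bar.has I t then (x : 𝔽) else 0 := rfl

lemma barMap_refl {𝔽 : Type} [Field 𝔽] {I : Bar} {t : ℝ} (x : barSub 𝔽 I t) :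
    barMap 𝔽 I t t x = x := by
  apply Subtype.ext
  rw [barMap_coe]
  split_ifs with hm
  · rfl
  · exact (barSub_coe_zero hm x).symm

lemma barMap_comp {𝔽 : Type} [Field 𝔽] {I : Bar} {s t r : ℝ} (hst : s ≤ t) (htr : t ≤ r)
    (x : barSub 𝔽 I s) :
    barMap 𝔽 I t r (barMap 𝔽 I s t x) = barMap 𝔽 I s r x := by
  apply Subtype.ext
  rw [barMap_coe, barMap_coe, barMap_coe]
  by_cases hr : Bar.has I r
  · by_cases ht : Bar.has I t
    · simp [hr, ht]
    · have ht2 : (t : EReal) ≤ I.2 := le_trans (by exact_mod_cast htr) hr.2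
      have ht1 : ¬ I.1 < t := fun h => ht ⟨h, ht2⟩
      have hs1 : ¬ Bar.has I s := fun hs => ht1 (lt_of_lt_of_le hs.1 hst)
      rw [barSub_coe_zero hs1 x]
      simp
  · simp [hr]

/-- The interval persistence module `𝔽(a,b]`. -/
def intervalModule (𝔽 : Type) [Field 𝔽] (I : Bar) : PersistenceModule 𝔽 where
  V t := ↥(barSub 𝔽 I t)
  π s t _ := barMap 𝔽 I s t
  π_refl t := LinearMap.ext fun x => barMap_refl x
  π_comp _ _ _ hst htr := LinearMap.ext fun x => barMap_comp hst htr x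

/-- The direct sum `⊕_{I ∈ B} 𝔽(I)` of the interval modules of the bars of a
barcode `B` (a finite multiset of bars), taken pointwise in `t`. -/
def barcodeModule (𝔽 : Type) [Field 𝔽] (B : Multiset Bar) : PersistenceModule 𝔽 where
  V t := ∀ i : Fin B.toList.length, ↥(barSub 𝔽 (B.toList.get i) t)
  π s t _ := LinearMap.pi fun i => (barMap 𝔽 (B.toList.get i) s t).comp (LinearMap.proj i)
  π_refl t := by
    apply LinearMap.ext
    intro x
    funext i
    simpa using barMap_refl (x i)
  π_comp s t r hst htr := by
    apply LinearMap.ext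
    intro x
    funext i
    simpa using barMap_comp hst htr (x i)

/-- `Multiset.filter` with classical decidability. -/
def cfilter {α : Type} (p : α → Prop) (s : Multiset α) : Multiset α :=
  @Multiset.filter α p (Classical.decPred p) s

/-- A bar of length `> 2δ`. -/
def BarLong (δ : ℝ) (I : Bar) : Prop := ((2 * δ : ℝ) : EReal) < I.2 - (I.1 : EReal)

/-- Two bars matched within error `δ`: left endpoints within `δ` of each other, and
either both right endpoints equal `+∞`, or both are finite and within `δ`. -/
def BarClose (δ : ℝ) (I J : Bar) : Prop :=
  |I.1 - J.1| ≤ δ ∧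
    ((I.2 = ⊤ ∧ J.2 = ⊤) ∨ (I.2 ≠ ⊤ ∧ J.2 ≠ ⊤ ∧ |EReal.toReal I.2 - EReal.toReal J.2| ≤ δ))

/-- A `δ`-matching between barcodes `B` and `C`, recorded as a multiset `m` of matched
pairs: it induces a partial bijection between a sub-multiset of `B` and a sub-multiset
of `C` which matches every bar of length `> 2δ` on both sides, and matched bars are
`δ`-close. -/
def IsMatching (δ : ℝ) (B C : Multiset Bar) (m : Multiset (Bar × Bar)) : Prop :=
  m.map Prod.fst ≤ B ∧ m.map Prod.snd ≤ C ∧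
  cfilter (BarLong δ) B ≤ m.map Prod.fst ∧
  cfilter (BarLong δ) C ≤ m.map Prod.snd ∧
  ∀ p ∈ m, BarClose δ p.1 p.2

/-- The bottleneck distance between two barcodes, with value in `EReal`. -/
def dBot (B C : Multiset Bar) : EReal :=
  sInf {x : EReal | ∃ δ : ℝ, 0 < δ ∧ x = (δ : EReal) ∧ ∃ m, IsMatching δ B C m}

/-- `m(B, (a,b])`: the number of bars of `B` (with multiplicity) containing `(a,b]`. -/
def multB (B : Multiset Bar) (a b : ℝ) : ℕ :=
  (cfilter (fun I : Bar => I.1 ≤ a ∧ (b : EReal) ≤ I.2) B).card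

/-- The multiplicity function `μ_k` of a barcode, with value in `EReal`
(it equals `0` if no suitable `c` exists). -/
def muk (k : ℕ) (B : Multiset Bar) : EReal :=
  sSup (insert (0 : EReal)
    {x : EReal | ∃ c : ℝ, 0 < c ∧ x = (c : EReal) ∧
      ∃ a b : ℝ, 4 * c < b - a ∧ multB B a b = k ∧ multB B (a + 2 * c) (b - 2 * c) = k})

/-- `μ_odd`: the supremum of `μ_k` over odd `k`. -/
def muOdd (B : Multiset Bar) : EReal :=
  sSup {x : EReal | ∃ k : ℕ, Odd k ∧ x = muk k B}

/-- `β_k`: the length of the `k`-th longest finite bar of a barcode (`0` if there are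
fewer than `k` finite bars). -/
def betak (k : ℕ) (B : Multiset Bar) : ℝ :=
  ((((cfilter (fun I : Bar => I.2 ≠ ⊤) B).map
      (fun I : Bar => EReal.toReal I.2 - I.1)).sort (· ≤ ·)).reverse).getD (k - 1) 0

end

/-- The size of a filtered multiset, counted through the positions of its underlying list. -/
lemma card_cfilter_eq {α : Type} (p : α → Prop) (B : Multiset α) :
    (cfilter p B).card = Fintype.card {i : Fin B.toList.length // p (B.toList.get i)} := by
  have hB : B = (Finset.univ : Finset (Fin B.toList.length)).val.map B.toList.get := by
    rw [Fin.univ_val_map, List.ofFn_get, Multiset.coe_toList]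
  rw [Fintype.card_subtype, cfilter]
  conv_lhs => rw [hB, Multiset.filter_map, Multiset.card_map]
  rw [Finset.card_def, Finset.filter_val]
  congr!

lemma barcodeModule_π_coe (𝔽 : Type) [Field 𝔽] (B : Multiset Bar) {s t : ℝ} (h : s ≤ t)
    (x : (barcodeModule 𝔽 B).V s) (i : Fin B.toList.length) :
    (((barcodeModule 𝔽 B).π s t h x i : barSub 𝔽 (B.toList.get i) t) : 𝔽)
      = if Bar.has (B.toList.get i) t then ((x i : barSub 𝔽 (B.toList.get i) s) : 𝔽) else 0 :=
  rfl

lemma barcodeModule_ext {𝔽 : Type} [Field 𝔽] {B : Multiset Bar} {t : ℝ}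
    {x y : (barcodeModule 𝔽 B).V t}
    (h : ∀ i, ((x i : barSub 𝔽 (B.toList.get i) t) : 𝔽)
      = ((y i : barSub 𝔽 (B.toList.get i) t) : 𝔽)) : x = y :=
  funext fun i => Subtype.ext (h i)

noncomputable section

/-- The inclusion at `t` of the coordinates of the bars which satisfy `p`. -/
def barcodeIncl (𝔽 : Type) [Field 𝔽] (B : Multiset Bar) (p : Bar → Prop) (t : ℝ)
    (hp : ∀ I ∈ B, p I → Bar.has I t) :
    ({i : Fin B.toList.length // p (B.toList.get i)} → 𝔽) →ₗ[𝔽] (barcodeModule 𝔽 B).V t :=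
  LinearMap.pi fun i => LinearMap.codRestrict (barSub 𝔽 (B.toList.get i) t)
    (if h : p (B.toList.get i) then LinearMap.proj ⟨i, h⟩ else 0) fun x => by
      by_cases h : p (B.toList.get i)
      · have := hp _ (Multiset.mem_toList.1 (List.get_mem _ i)) h
        rw [barSub, if_pos this]
        trivial
      · simp only [dif_neg h, LinearMap.zero_apply, Submodule.zero_mem]

lemma barcodeIncl_coe_of_pos {𝔽 : Type} [Field 𝔽] {B : Multiset Bar} {p : Bar → Prop} {t : ℝ}
    (hp : ∀ I ∈ B, p I → Bar.has I t)
    (x : {i : Fin B.toList.length // p (B.toList.get i)} → 𝔽)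
    (i : Fin B.toList.length) (h : p (B.toList.get i)) :
    ((barcodeIncl 𝔽 B p t hp x i : barSub 𝔽 (B.toList.get i) t) : 𝔽) = x ⟨i, h⟩ := by
  change (dite (p (B.toList.get i)) (fun h => LinearMap.proj (R := 𝔽) ⟨i, h⟩) (fun _ => 0) :
    ({i : Fin B.toList.length // p (B.toList.get i)} → 𝔽) →ₗ[𝔽] 𝔽) x = _
  rw [dif_pos h]
  rfl

lemma barcodeIncl_coe_of_neg {𝔽 : Type} [Field 𝔽] {B : Multiset Bar} {p : Bar → Prop} {t : ℝ}
    (hp : ∀ I ∈ B, p I → Bar.has I t)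
    (x : {i : Fin B.toList.length // p (B.toList.get i)} → 𝔽)
    (i : Fin B.toList.length) (h : ¬ p (B.toList.get i)) :
    ((barcodeIncl 𝔽 B p t hp x i : barSub 𝔽 (B.toList.get i) t) : 𝔽) = 0 := by
  change (dite (p (B.toList.get i)) (fun h => LinearMap.proj (R := 𝔽) ⟨i, h⟩) (fun _ => 0) :
    ({i : Fin B.toList.length // p (B.toList.get i)} → 𝔽) →ₗ[𝔽] 𝔽) x = _
  rw [dif_neg h]
  rfl

/-- The projection at `t` to the coordinates of the bars which satisfy `p`. -/
def barcodeProj (𝔽 : Type) [Field 𝔽] (B : Multiset Bar) (p : Bar → Prop) (t : ℝ) :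
    (barcodeModule 𝔽 B).V t →ₗ[𝔽] ({i : Fin B.toList.length // p (B.toList.get i)} → 𝔽) :=
  LinearMap.pi fun i => (barSub 𝔽 (B.toList.get i) t).subtype.comp (LinearMap.proj i.1)

end

namespace PersistenceModule

lemma Hom.comm_apply {𝔽 : Type} [Field 𝔽] {M N : PersistenceModule 𝔽} (f : Hom M N)
    {s t : ℝ} (h : s ≤ t) (x : M.V s) :
    f.A t (M.π s t h x) = N.π s t h (f.A s x) :=
  LinearMap.congr_fun (f.comm s t h) x

/-- Composition of morphisms of persistence modules. -/
def Hom.trans {𝔽 : Type} [Field 𝔽] {M N P : PersistenceModule 𝔽} (f : Hom M N) (g : Hom N P) :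
    Hom M P where
  A t := (g.A t).comp (f.A t)
  comm s t h := by
    ext x
    simp only [LinearMap.comp_apply, Hom.comm_apply]

end PersistenceModule

/-- A parameter just above `b`: no bar of `C` is born strictly between `b` and it. -/
lemma exists_gt_forall_le_left (C : Multiset Bar) {b : ℝ} {d : EReal} (hbd : (b : EReal) < d) :
    ∃ s : ℝ, b < s ∧ (s : EReal) < d ∧ ∀ I ∈ C, I.1 < s → I.1 ≤ b := by
  induction C using Multiset.induction_on with
  | empty =>
    obtain ⟨s, hs, hsd⟩ := EReal.lt_iff_exists_real_btwn.1 hbd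
    exact ⟨s, by exact_mod_cast hs, hsd, by simp⟩
  | cons J C ih =>
    obtain ⟨s, hs, hsd, hC⟩ := ih
    rcases le_or_gt J.1 b with hJ | hJ
    · refine ⟨s, hs, hsd, fun I hI hIs => ?_⟩
      rcases Multiset.mem_cons.1 hI with rfl | hI
      exacts [hJ, hC I hI hIs]
    · refine ⟨min s J.1, lt_min hs hJ,
        lt_of_le_of_lt (by exact_mod_cast min_le_left s J.1) hsd, fun I hI hIs => ?_⟩
      rcases Multiset.mem_cons.1 hI with rfl | hI
      exacts [absurd hIs (min_le_right _ _).not_gt, hC I hI (hIs.trans_le (min_le_left _ _))]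

/-- A parameter up to `d`: every bar of `C` which survives until it survives until `d`. -/
lemma exists_le_forall_le_right (C : Multiset Bar) {s : ℝ} {d : EReal} (hsd : (s : EReal) < d) :
    ∃ u : ℝ, s ≤ u ∧ (u : EReal) ≤ d ∧ ∀ I ∈ C, (u : EReal) ≤ I.2 → d ≤ I.2 := by
  induction C using Multiset.induction_on with
  | empty => exact ⟨s, le_rfl, hsd.le, by simp⟩
  | cons J C ih =>
    obtain ⟨u, hu, hud, hC⟩ := ih
    rcases le_or_gt d J.2 with hJ | hJ
    · refine ⟨u, hu, hud, fun I hI hIu => ?_⟩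
      rcases Multiset.mem_cons.1 hI with rfl | hI
      exacts [hJ, hC I hI hIu]
    · obtain ⟨w, hJw, hwd⟩ : ∃ w : ℝ, J.2 < w ∧ (w : EReal) ≤ d :=
        let ⟨w, h, h'⟩ := EReal.lt_iff_exists_real_btwn.1 hJ
        ⟨w, h, h'.le⟩
      refine ⟨max u w, hu.trans (le_max_left _ _), ?_, fun I hI hIu => ?_⟩
      · rcases max_choice u w with h | h <;> rw [h] <;> assumption
      · have huI : (u : EReal) ≤ I.2 := le_trans (by exact_mod_cast le_max_left u w) hIu
        have hwI : (w : EReal) ≤ I.2 := le_trans (by exact_mod_cast le_max_right u w) hIu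
        rcases Multiset.mem_cons.1 hI with rfl | hI
        exacts [absurd hwI hJw.not_ge, hC I hI huI]

/-- Monotonicity with respect to injections, for direct sums of interval modules. -/
lemma card_cfilter_le_of_barcodeModule_injective {𝔽 : Type} [Field 𝔽] {B C : Multiset Bar}
    (f : PersistenceModule.Hom (barcodeModule 𝔽 B) (barcodeModule 𝔽 C))
    (hf : ∀ t : ℝ, Function.Injective (f.A t)) {b : ℝ} {d : EReal} (hbd : (b : EReal) < d) :
    (cfilter (fun I : Bar => I.1 ≤ b ∧ I.2 = d) B).card
      ≤ (cfilter (fun I : Bar => I.1 ≤ b ∧ I.2 = d) C).card := by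
  obtain ⟨s, hbs, hsd, hs⟩ := exists_gt_forall_le_left C hbd
  obtain ⟨u, hsu, hud, hu⟩ := exists_le_forall_le_right C hsd
  set p : Bar → Prop := fun I => I.1 ≤ b ∧ I.2 = d
  have hps : ∀ I ∈ B, p I → Bar.has I s := fun I _ h =>
    ⟨h.1.trans_lt hbs, by rw [h.2]; exact hsd.le⟩
  let φ := (barcodeProj 𝔽 C p s).comp ((f.A s).comp (barcodeIncl 𝔽 B p s hps))
  have hφ : Function.Injective φ := by
    rw [injective_iff_map_eq_zero]
    intro x hx
    set X := barcodeIncl 𝔽 B p s hps x with hX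
    have hdead : ∀ v : ℝ, ∀ hv : s ≤ v, d < v → (barcodeModule 𝔽 B).π s v hv X = 0 := by
      intro v hv hdv
      refine barcodeModule_ext fun i => ?_
      rw [barcodeModule_π_coe]
      by_cases h : p (B.toList.get i)
      · exact if_neg fun hi => (hi.2.trans h.2.le).not_gt hdv
      · rw [hX, barcodeIncl_coe_of_neg hps x i h, ite_self]
        rfl
    have hY : (barcodeModule 𝔽 C).π s u hsu (f.A s X) = 0 := by
      refine barcodeModule_ext fun j => ?_
      rw [barcodeModule_π_coe]
      change _ = (0 : 𝔽)
      have hj : C.toList.get j ∈ C := Multiset.mem_toList.1 (List.get_mem _ j)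
      by_cases hju : Bar.has (C.toList.get j) u
      swap
      · exact if_neg hju
      rw [if_pos hju]
      by_cases hjs : Bar.has (C.toList.get j) s
      swap
      · exact barSub_coe_zero hjs _
      rcases (hu _ hj hju.2).eq_or_lt with h | h
      · exact congrFun hx ⟨j, hs _ hj hjs.1, h.symm⟩
      · obtain ⟨v, hdv, hvj⟩ := EReal.lt_iff_exists_real_btwn.1 h
        have hsv : s ≤ v := by exact_mod_cast (hsd.trans hdv).le
        have h0 := f.comm_apply hsv X
        rw [hdead v hsv hdv, map_zero] at h0
        have h1 := barcodeModule_π_coe 𝔽 C hsv (f.A s X) j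
        rw [← h0, if_pos ⟨hjs.1.trans_le hsv, hvj.le⟩] at h1
        exact h1.symm
    rw [← f.comm_apply hsu] at hY
    have hXu := (injective_iff_map_eq_zero (f.A u)).1 (hf u) _ hY
    funext i
    have h1 := barcodeModule_π_coe 𝔽 B hsu X i.1
    have hiu : Bar.has (B.toList.get i.1) u :=
      ⟨i.2.1.trans_lt (hbs.trans_le hsu), by rw [i.2.2]; exact hud⟩
    rw [hXu, if_pos hiu, hX, barcodeIncl_coe_of_pos hps x i.1 i.2] at h1
    exact h1.symm
  have := LinearMap.finrank_le_finrank_of_injective hφ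
  rw [Module.finrank_fintype_fun_eq_card, Module.finrank_fintype_fun_eq_card] at this
  rw [card_cfilter_eq, card_cfilter_eq]
  convert this

/-- **Monotonicity with respect to injections.** If there is a pointwise injective
morphism `ι : M → N`, then for every `b ∈ ℝ` and `d` with `b < d ≤ +∞`, the number of
bars `(a,d] ∈ B` with `a ≤ b` is at most the number of bars `(a,d] ∈ C` with `a ≤ b`. -/
theorem monotonicity_injections {𝔽 : Type} [Field 𝔽]
    (M N : PersistenceModule 𝔽) (hM : M.IsRegular) (hN : N.IsRegular)
    (B C : Multiset Bar) (hB : ∀ I ∈ B, Bar.valid I) (hC : ∀ I ∈ C, Bar.valid I)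
    (hMB : PersistenceModule.Iso M (barcodeModule 𝔽 B))
    (hNC : PersistenceModule.Iso N (barcodeModule 𝔽 C))
    (ι : PersistenceModule.Hom M N) (hι : ∀ t : ℝ, Function.Injective (ι.A t))
    (b : ℝ) (d : EReal) (hbd : (b : EReal) < d) :
    (cfilter (fun I : Bar => I.1 ≤ b ∧ I.2 = d) B).card
      ≤ (cfilter (fun I : Bar => I.1 ≤ b ∧ I.2 = d) C).card := by
  obtain ⟨_, g, _, hg⟩ := hMB
  obtain ⟨k, l, hk, _⟩ := hNC
  exact card_cfilter_le_of_barcodeModule_injective ((g.trans ι).trans k)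
    (fun t => (Function.LeftInverse.injective (hk t)).comp
      ((hι t).comp (Function.LeftInverse.injective (hg t)))) hbd
end

section
/- Monotonicity with respect to surjections: Let V and W be persistence modules with V ≅ ⊕_{I∈B} 𝔽(I) and W ≅ ⊕_{J∈C} 𝔽(J) for finite multisets of intervals B and C. If there exists a morphism σ : V → W such that σ_t is surjective for every t ∈ ℝ, then for every b ∈ ℝ and every d with b < d ≤ +∞, the number (counted with multiplicity) of bars (b,c] ∈ B with c ≥ d is at least the number of bars (b,c] ∈ C with c ≥ d. -/
open Classical

/-- The inclusion of scalars into the fiber of an interval module, zero off the interval. -/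
noncomputable def barIn (𝔽 : Type) [Field 𝔽] (I : Bar) (t : ℝ) : 𝔽 →ₗ[𝔽] barSub 𝔽 I t where
  toFun c := ⟨if Bar.has I t then c else 0, by
    split_ifs with hm
    · simp [barSub, hm]
    · exact (barSub 𝔽 I t).zero_mem⟩
  map_add' x y := by
    apply Subtype.ext
    by_cases hm : Bar.has I t <;> simp [hm]
  map_smul' c x := by
    apply Subtype.ext
    by_cases hm : Bar.has I t <;> simp [hm]

lemma barIn_coe (𝔽 : Type) [Field 𝔽] (I : Bar) (t : ℝ) (c : 𝔽) :
    (barIn 𝔽 I t c : 𝔽) = if Bar.has I t then c else 0 := rfl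

namespace PersistenceModule

variable {𝔽 : Type} [Field 𝔽]

/-- Composition of morphisms of persistence modules. -/
def Hom.comp {M N P : PersistenceModule 𝔽} (g : Hom N P) (f : Hom M N) : Hom M P where
  A t := (g.A t).comp (f.A t)
  comm s t h := by
    rw [LinearMap.comp_assoc, f.comm, ← LinearMap.comp_assoc, g.comm, LinearMap.comp_assoc]

end PersistenceModule

lemma card_cfilter_eq_card_subtype {α : Type} (p : α → Prop) (s : Multiset α) :
    (cfilter p s).card = Nat.card {i : Fin s.toList.length // p (s.toList.get i)} := by
  have hs : s = (Finset.univ : Finset (Fin s.toList.length)).val.map s.toList.get := by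
    rw [Fin.univ_val_map, List.ofFn_get, Multiset.coe_toList]
  rw [Nat.card_eq_fintype_card, Fintype.card_subtype]
  conv_lhs => rw [hs]
  rw [cfilter, Multiset.filter_map, Multiset.card_map]
  simp only [Finset.card_def, Finset.filter_val]
  congr!

/-- Right endpoints of finitely many bars cannot distinguish `d` from a suitable real number. -/
lemma exists_real_le_iff_le (B : Multiset Bar) (b : ℝ) (d : EReal) (hbd : (b : EReal) < d) :
    ∃ t : ℝ, b < t ∧ ∀ I ∈ B, ((t : EReal) ≤ I.2 ↔ d ≤ I.2) := by
  induction d with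
  | bot => exact absurd hbd not_lt_bot
  | coe r => exact ⟨r, by exact_mod_cast hbd, fun _ _ => Iff.rfl⟩
  | top =>
    obtain ⟨m, hm⟩ := (B.toFinset.image fun I : Bar => I.2.toReal).bddAbove
    refine ⟨max b m + 1, by linarith [le_max_left b m], fun I hI => ?_⟩
    refine ⟨fun h => ?_, fun h => le_top.trans h⟩
    by_contra hne
    rw [top_le_iff] at hne
    have hle : I.2.toReal ≤ m :=
      hm (Finset.mem_coe.2 (Finset.mem_image_of_mem _ (Multiset.mem_toFinset.2 hI)))
    have hreal : I.2 ≤ (I.2.toReal : EReal) := EReal.le_coe_toReal hne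
    have : max b m + 1 ≤ I.2.toReal := EReal.coe_le_coe_iff.1 (h.trans hreal)
    linarith [le_max_right b m]

/-- No left endpoint of finitely many bars lies in `(b, s)` for `s > b` sufficiently small. -/
lemma exists_le_forall_lt_imp_le (B : Multiset Bar) {b t : ℝ} (hbt : b < t) :
    ∃ s : ℝ, b < s ∧ s ≤ t ∧ ∀ I ∈ B, I.1 < s → I.1 ≤ b := by
  induction B using Multiset.induction with
  | empty => exact ⟨t, hbt, le_rfl, by simp⟩
  | cons J B ih =>
    obtain ⟨s, hbs, hst, hs⟩ := ih
    by_cases hJ : J.1 ≤ b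
    · refine ⟨s, hbs, hst, fun I hI h => ?_⟩
      rcases Multiset.mem_cons.1 hI with rfl | hI
      · exact hJ
      · exact hs I hI h
    · refine ⟨min s J.1, lt_min hbs (not_le.1 hJ), (min_le_left _ _).trans hst, fun I hI h => ?_⟩
      rcases Multiset.mem_cons.1 hI with rfl | hI
      · exact absurd h (min_le_right _ _).not_gt
      · exact hs I hI (h.trans_le (min_le_left _ _))

/-- Monotonicity of bar counts under surjections of barcode modules, at real parameters. -/
lemma card_cfilter_le_of_surjective {𝔽 : Type} [Field 𝔽] {B C : Multiset Bar}
    (τ : PersistenceModule.Hom (barcodeModule 𝔽 B) (barcodeModule 𝔽 C))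
    {b s t : ℝ} (hτ : Function.Surjective (τ.A s)) (hbs : b < s) (hst : s ≤ t)
    (hs : ∀ I ∈ B, I.1 < s → I.1 ≤ b) :
    (cfilter (fun I : Bar => I.1 = b ∧ (t : EReal) ≤ I.2) C).card
      ≤ (cfilter (fun I : Bar => I.1 = b ∧ (t : EReal) ≤ I.2) B).card := by
  rw [card_cfilter_eq_card_subtype, card_cfilter_eq_card_subtype]
  set p : Bar → Prop := fun I => I.1 = b ∧ (t : EReal) ≤ I.2
  have hbt : b ≤ t := hbs.le.trans hst
  have has_t : ∀ I, p I → Bar.has I t := fun I h => ⟨h.1 ▸ hbs.trans_le hst, h.2⟩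
  have has_s : ∀ I, p I → Bar.has I s := fun I h =>
    ⟨h.1 ▸ hbs, le_trans (by exact_mod_cast hst) h.2⟩
  have not_has_b : ∀ I, p I → ¬ Bar.has I b := fun I h h' => h'.1.ne h.1
  let ι : ({i : Fin B.toList.length // p (B.toList.get i)} → 𝔽) →ₗ[𝔽] (barcodeModule 𝔽 B).V t :=
    LinearMap.pi fun i => (barIn 𝔽 (B.toList.get i) t).comp
      (if h : p (B.toList.get i) then LinearMap.proj ⟨i, h⟩ else 0)
  let ρ : (barcodeModule 𝔽 C).V t →ₗ[𝔽] ({j : Fin C.toList.length // p (C.toList.get j)} → 𝔽) :=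
    LinearMap.pi fun j => (barSub 𝔽 (C.toList.get j) t).subtype.comp (LinearMap.proj j.1)
  have hsurj : Function.Surjective (ρ ∘ₗ τ.A t ∘ₗ ι) := by
    intro w
    obtain ⟨v, hv⟩ := hτ (fun j => barIn 𝔽 (C.toList.get j) s
      (if h : p (C.toList.get j) then w ⟨j, h⟩ else 0))
    let u : (barcodeModule 𝔽 B).V b := fun i => barIn 𝔽 (B.toList.get i) b (v i : 𝔽)
    let f : {i : Fin B.toList.length // p (B.toList.get i)} → 𝔽 := fun i => (v i.1 : 𝔽)
    refine ⟨f, ?_⟩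
    have hdecomp : (barcodeModule 𝔽 B).π s t hst v = ι f + (barcodeModule 𝔽 B).π b t hbt u := by
      funext i
      apply Subtype.ext
      change (barMap 𝔽 (B.toList.get i) s t (v i) : 𝔽) = (barIn 𝔽 (B.toList.get i) t
        ((if h : p (B.toList.get i) then LinearMap.proj ⟨i, h⟩ else 0 :
          ({i : Fin B.toList.length // p (B.toList.get i)} → 𝔽) →ₗ[𝔽] 𝔽) f) : 𝔽)
        + (barMap 𝔽 (B.toList.get i) b t (barIn 𝔽 (B.toList.get i) b (v i : 𝔽)) : 𝔽)
      rw [barMap_coe, barMap_coe, barIn_coe, barIn_coe]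
      by_cases ht : Bar.has (B.toList.get i) t
      · by_cases hpi : p (B.toList.get i)
        · simp only [if_pos ht, dif_pos hpi, if_neg (not_has_b _ hpi), add_zero]
          rfl
        · simp only [if_pos ht, dif_neg hpi, LinearMap.zero_apply, zero_add]
          split_ifs with hb
          · rfl
          · refine barSub_coe_zero (fun hi => ?_) (v i)
            have hle := hs _ (Multiset.mem_toList.1 (List.get_mem _ i)) hi.1
            rcases hle.eq_or_lt with heq | hlt
            · exact hpi ⟨heq, ht.2⟩
            · exact hb ⟨hlt, le_trans (by exact_mod_cast hbt) ht.2⟩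
      · simp only [if_neg ht, add_zero]
    have hcomm_s := LinearMap.congr_fun (τ.comm s t hst) v
    have hcomm_b := LinearMap.congr_fun (τ.comm b t hbt) u
    simp only [LinearMap.comp_apply] at hcomm_s hcomm_b
    rw [hdecomp, map_add, hcomm_b, hv] at hcomm_s
    funext j
    have hj := congrArg Subtype.val (congrFun hcomm_s j.1)
    change ((τ.A t (ι f) j.1 : barSub 𝔽 _ t) : 𝔽)
      + (barMap 𝔽 (C.toList.get j.1) b t (τ.A b u j.1) : 𝔽)
      = (barMap 𝔽 (C.toList.get j.1) s t (barIn 𝔽 (C.toList.get j.1) s _) : 𝔽) at hj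
    rw [barMap_coe, barMap_coe, barIn_coe, barSub_coe_zero (not_has_b _ j.2) (τ.A b u j.1),
      if_pos (has_t _ j.2), if_pos (has_t _ j.2), if_pos (has_s _ j.2), dif_pos j.2, add_zero] at hj
    exact hj
  have hrank := LinearMap.finrank_le_finrank_of_surjective hsurj
  rwa [Module.finrank_fintype_fun_eq_card, Module.finrank_fintype_fun_eq_card,
    ← Nat.card_eq_fintype_card, ← Nat.card_eq_fintype_card] at hrank

/-- **Monotonicity with respect to surjections.** If there is a pointwise surjective
morphism `σ : M → N`, then for every `b ∈ ℝ` and `d` with `b < d ≤ +∞`, the number of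
bars `(b,c] ∈ B` with `c ≥ d` is at least the number of bars `(b,c] ∈ C` with
`c ≥ d`. -/
theorem monotonicity_surjections {𝔽 : Type} [Field 𝔽]
    (M N : PersistenceModule 𝔽) (hM : M.IsRegular) (hN : N.IsRegular)
    (B C : Multiset Bar) (hB : ∀ I ∈ B, Bar.valid I) (hC : ∀ I ∈ C, Bar.valid I)
    (hMB : PersistenceModule.Iso M (barcodeModule 𝔽 B))
    (hNC : PersistenceModule.Iso N (barcodeModule 𝔽 C))
    (σ : PersistenceModule.Hom M N) (hσ : ∀ t : ℝ, Function.Surjective (σ.A t))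
    (b : ℝ) (d : EReal) (hbd : (b : EReal) < d) :
    (cfilter (fun I : Bar => I.1 = b ∧ d ≤ I.2) C).card
      ≤ (cfilter (fun I : Bar => I.1 = b ∧ d ≤ I.2) B).card := by
  obtain ⟨f₀, g, hg, -⟩ := hMB
  obtain ⟨f, f₁, -, hf⟩ := hNC
  obtain ⟨t, hbt, ht⟩ := exists_real_le_iff_le (B + C) b d hbd
  obtain ⟨s, hbs, hst, hs⟩ := exists_le_forall_lt_imp_le B hbt
  have hg' : Function.Surjective (g.A s) := fun x => ⟨_, hg s x⟩
  have hf' : Function.Surjective (f.A s) := fun y => ⟨_, hf s y⟩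
  have hτ : Function.Surjective ((f.comp (σ.comp g)).A s) := hf'.comp ((hσ s).comp hg')
  have hle := card_cfilter_le_of_surjective (f.comp (σ.comp g)) hτ hbs hst hs
  have hcongr : ∀ D ≤ B + C, cfilter (fun I : Bar => I.1 = b ∧ (t : EReal) ≤ I.2) D
      = cfilter (fun I : Bar => I.1 = b ∧ d ≤ I.2) D := fun D hD =>
    @Multiset.filter_congr _ _ _ (Classical.decPred _) (Classical.decPred _) _ fun I hI =>
      and_congr_right fun _ => ht I (Multiset.mem_of_le hD hI)
  rwa [hcongr B (Multiset.le_add_right B C), hcongr C (Multiset.le_add_left C B)] at hle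
end

section
/- Induced matching for surjections: Let V and W be persistence modules with V ≅ ⊕_{I∈B} 𝔽(I) and W ≅ ⊕_{J∈C} 𝔽(J) for finite multisets of intervals B and C. If there exists a morphism σ : V → W with σ_t surjective for every t ∈ ℝ, then there exists an injective map μ from the multiset C into the multiset B such that for every bar (b,e] ∈ C the bar μ(b,e] has the form (b,d] with the same left endpoint b and with d ≥ e. -/
open Classical

open Filter Topology

/-- The coordinates of an element of the fiber at `t` of a barcode module. -/
noncomputable def barcodeCoord (𝔽 : Type) [Field 𝔽] (B : Multiset Bar) (t : ℝ) :
    (barcodeModule 𝔽 B).V t →ₗ[𝔽] (Fin B.toList.length → 𝔽) :=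
  LinearMap.pi fun i => (barSub 𝔽 (B.toList.get i) t).subtype.comp (LinearMap.proj i)

/-- The projection of the scalars onto the fiber at `t` of an interval module. -/
noncomputable def barTrunc (𝔽 : Type) [Field 𝔽] (I : Bar) (t : ℝ) : 𝔽 →ₗ[𝔽] barSub 𝔽 I t :=
  LinearMap.codRestrict (barSub 𝔽 I t) (if Bar.has I t then LinearMap.id else 0) fun x => by
    by_cases h : Bar.has I t
    · rw [barSub, if_pos h]
      exact Submodule.mem_top
    · rw [if_neg h]
      exact Submodule.zero_mem _

/-- Truncation of a vector of scalars to the bars that contain `t`. -/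
noncomputable def barcodeTrunc (𝔽 : Type) [Field 𝔽] (B : Multiset Bar) (t : ℝ) :
    (Fin B.toList.length → 𝔽) →ₗ[𝔽] (barcodeModule 𝔽 B).V t :=
  LinearMap.pi fun i => (barTrunc 𝔽 (B.toList.get i) t).comp (LinearMap.proj i)

section Coordinates

variable {𝔽 : Type} [Field 𝔽] {B : Multiset Bar}

lemma barcodeCoord_injective (t : ℝ) : Function.Injective (barcodeCoord 𝔽 B t) := by
  intro x y h
  funext i
  exact Subtype.ext (congrFun h i)

lemma barcodeCoord_of_not_has {t : ℝ} (x : (barcodeModule 𝔽 B).V t)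
    {i : Fin B.toList.length} (h : ¬ Bar.has (B.toList.get i) t) : barcodeCoord 𝔽 B t x i = 0 :=
  barSub_coe_zero h _

lemma barcodeCoord_trunc (t : ℝ) (v : Fin B.toList.length → 𝔽) (i : Fin B.toList.length) :
    barcodeCoord 𝔽 B t (barcodeTrunc 𝔽 B t v) i =
      if Bar.has (B.toList.get i) t then v i else 0 := by
  change ((if Bar.has (B.toList.get i) t then LinearMap.id else 0 : 𝔽 →ₗ[𝔽] 𝔽)) (v i) = _
  split_ifs <;> rfl

lemma barcodeCoord_π {s t : ℝ} (h : s ≤ t) (x : (barcodeModule 𝔽 B).V s)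
    (i : Fin B.toList.length) :
    barcodeCoord 𝔽 B t ((barcodeModule 𝔽 B).π s t h x) i =
      if Bar.has (B.toList.get i) t then barcodeCoord 𝔽 B s x i else 0 :=
  rfl

end Coordinates

/-- A pointwise surjection of barcode modules does not increase the number of bars that start
at `b` and contain `(b, e]`, where `t ∈ (b, e]` is so close to `b` that no bar starts in
`(b, t)`. -/
lemma card_bars_le_of_surjective {𝔽 : Type} [Field 𝔽] {B C : Multiset Bar}
    (σ : PersistenceModule.Hom (barcodeModule 𝔽 B) (barcodeModule 𝔽 C))
    (hσ : ∀ t, Function.Surjective (σ.A t)) {b t e : ℝ} (hbt : b < t) (hte : t ≤ e)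
    (hgap : ∀ I ∈ B, I.1 < t → I.1 ≤ b) :
    Fintype.card {j // (C.toList.get j).1 = b ∧ (e : EReal) ≤ (C.toList.get j).2} ≤
      Fintype.card {i // (B.toList.get i).1 = b ∧ (e : EReal) ≤ (B.toList.get i).2} := by
  set S := {i // (B.toList.get i).1 = b ∧ (e : EReal) ≤ (B.toList.get i).2}
  set T := {j // (C.toList.get j).1 = b ∧ (e : EReal) ≤ (C.toList.get j).2}
  let φ : (S → 𝔽) →ₗ[𝔽] (T → 𝔽) :=
    (LinearMap.funLeft 𝔽 𝔽 (Subtype.val : T → _)).comp <| (barcodeCoord 𝔽 C e).comp <|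
      (σ.A e).comp <| (barcodeTrunc 𝔽 B e).comp <|
        Function.ExtendByZero.linearMap 𝔽 (Subtype.val : S → _)
  have hφ : Function.Surjective φ := by
    intro y
    obtain ⟨x, hx⟩ := hσ t (barcodeTrunc 𝔽 C t (Function.extend Subtype.val y 0))
    let v := barcodeCoord 𝔽 B t x
    let w : S → 𝔽 := fun i => v i
    let v₁ : Fin B.toList.length → 𝔽 := Function.ExtendByZero.linearMap 𝔽 Subtype.val w
    have hbe : b ≤ e := hbt.le.trans hte
    have hsplit : (barcodeModule 𝔽 B).π t e hte x =
        barcodeTrunc 𝔽 B e v₁ +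
          (barcodeModule 𝔽 B).π b e hbe (barcodeTrunc 𝔽 B b (v - v₁)) := by
      apply barcodeCoord_injective
      funext i
      rw [map_add, Pi.add_apply, barcodeCoord_π, barcodeCoord_π, barcodeCoord_trunc,
        barcodeCoord_trunc]
      by_cases he : Bar.has (B.toList.get i) e
      · simp only [he, if_true]
        by_cases hb : Bar.has (B.toList.get i) b
        · simp only [hb, if_true, Pi.sub_apply, add_sub_cancel]
          rfl
        · have hb1 : b ≤ (B.toList.get i).1 := by
            by_contra! hlt
            exact hb ⟨hlt, le_trans (by exact_mod_cast hbe) he.2⟩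
          simp only [hb, if_false, add_zero]
          by_cases hi : (B.toList.get i).1 = b
          · exact (Subtype.val_injective.extend_apply w 0 (⟨i, hi, he.2⟩ : S)).symm
          · have hv₁ : v₁ i = 0 := by
              refine Function.extend_apply' w (0 : Fin B.toList.length → 𝔽) i ?_
              rintro ⟨k, rfl⟩
              exact hi k.2.1
            rw [hv₁]
            apply barcodeCoord_of_not_has
            intro ht
            exact hi (le_antisymm
              (hgap _ (Multiset.mem_toList.mp (List.get_mem _ i)) ht.1) hb1)
      · simp only [he, if_false, add_zero]
    refine ⟨w, funext fun j => ?_⟩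
    have hjt : Bar.has (C.toList.get j) t :=
      ⟨j.2.1.trans_lt hbt, le_trans (by exact_mod_cast hte) j.2.2⟩
    have hje : Bar.has (C.toList.get j) e := ⟨j.2.1.trans_lt (hbt.trans_le hte), j.2.2⟩
    have hjb : ¬ Bar.has (C.toList.get j) b := fun h => h.1.ne j.2.1
    have hσx := LinearMap.congr_fun (σ.comm t e hte) x
    have hσb := LinearMap.congr_fun (σ.comm b e hbe) (barcodeTrunc 𝔽 B b (v - v₁))
    simp only [LinearMap.comp_apply] at hσx hσb
    rw [hsplit, map_add, hσb, hx] at hσx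
    have key := congrFun (congrArg (barcodeCoord 𝔽 C e) hσx) j
    rw [map_add, Pi.add_apply, barcodeCoord_π, barcodeCoord_π, barcodeCoord_trunc, if_pos hje,
      if_pos hje, if_pos hjt, barcodeCoord_of_not_has _ hjb, add_zero,
      Subtype.val_injective.extend_apply] at key
    exact key
  have := LinearMap.finrank_le_finrank_of_surjective hφ
  simpa only [Module.finrank_fintype_fun_eq_card] using this

/-- Every right endpoint `d` above `b` can be replaced by a real threshold `e` that is exceeded by
the same right endpoints. -/
lemma exists_real_threshold (S : Finset Bar) {b : ℝ} {d : EReal} (h : (b : EReal) < d) :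
    ∃ e : ℝ, b < e ∧ ∀ I ∈ S, (e : EReal) ≤ I.2 ↔ d ≤ I.2 := by
  induction d with
  | bot => simp at h
  | coe d => exact ⟨d, by exact_mod_cast h, fun _ _ => Iff.rfl⟩
  | top =>
    have hS : ∀ᶠ e : ℝ in atTop, ∀ I ∈ S, (e : EReal) ≤ I.2 ↔ ⊤ ≤ I.2 := by
      rw [Filter.eventually_all_finset]
      rintro ⟨a, c⟩ -
      induction c with
      | bot => simp
      | coe c =>
        filter_upwards [eventually_gt_atTop c] with e he
        simpa using he
      | top => simp
    exact ((eventually_gt_atTop b).and hS).exists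

lemma exists_gap (S : Finset Bar) {b e : ℝ} (h : b < e) :
    ∃ t, b < t ∧ t ≤ e ∧ ∀ I ∈ S, I.1 < t → I.1 ≤ b := by
  have hS : ∀ᶠ t in 𝓝[>] b, ∀ I ∈ S, I.1 < t → I.1 ≤ b := by
    rw [Filter.eventually_all_finset]
    intro I _
    rcases le_or_gt I.1 b with hI | hI
    · exact Eventually.of_forall fun _ _ => hI
    · filter_upwards [Ioo_mem_nhdsGT hI] with t ht hlt
      exact absurd hlt ht.2.le.not_gt
  obtain ⟨t, ⟨h₁, h₂⟩, h₃⟩ := ((eventually_mem_set.mpr (Ioc_mem_nhdsGT h)).and hS).exists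
  exact ⟨t, h₁, h₂, h₃⟩

/-- If each left endpoint is shared by at least as many `g`-bars as `f`-bars past every threshold,
then `f`-bars can be matched injectively to longer `g`-bars with the same left endpoint. -/
lemma exists_injective_bar_matching {ι κ : Type} [Fintype ι] [Fintype κ] (f : ι → Bar) (g : κ → Bar)
    (h : ∀ i, Fintype.card {i' // (f i').1 = (f i).1 ∧ (f i).2 ≤ (f i').2} ≤
      Fintype.card {k // (g k).1 = (f i).1 ∧ (f i).2 ≤ (g k).2}) :
    ∃ μ : ι → κ, Function.Injective μ ∧ ∀ i, (g (μ i)).1 = (f i).1 ∧ (f i).2 ≤ (g (μ i)).2 := by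
  let r : ι → Finset κ := fun i => {k | (g k).1 = (f i).1 ∧ (f i).2 ≤ (g k).2}
  suffices hall : ∀ s : Finset ι, s.card ≤ (s.biUnion r).card by
    obtain ⟨μ, hμ, hr⟩ := (Finset.all_card_le_biUnion_card_iff_exists_injective r).mp hall
    exact ⟨μ, hμ, fun i => by simpa [r] using hr i⟩
  intro s
  rw [Finset.card_eq_sum_card_fiberwise (f := fun i => (f i).1) (t := s.image fun i => (f i).1)
      (fun i hi => Finset.mem_coe.mpr (Finset.mem_image_of_mem _ hi)),
    Finset.card_eq_sum_card_fiberwise (f := fun k => (g k).1) (t := s.image fun i => (f i).1)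
      (s := s.biUnion r)]
  · refine Finset.sum_le_sum fun b hb => ?_
    obtain ⟨i₀, hi₀, rfl⟩ := Finset.mem_image.mp hb
    obtain ⟨i, hi, hmin⟩ := Finset.exists_min_image (s.filter fun i => (f i).1 = (f i₀).1)
      (fun i => (f i).2) ⟨i₀, by simp [hi₀]⟩
    rw [Finset.mem_filter] at hi
    have hi' := h i
    rw [Fintype.card_subtype, Fintype.card_subtype] at hi'
    refine (Finset.card_le_card ?_).trans (hi'.trans (Finset.card_le_card ?_))
    · intro i' hi'
      have := hmin i' hi'
      simp only [Finset.mem_filter, Finset.mem_univ, true_and] at hi' ⊢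
      exact ⟨hi'.2.trans hi.2.symm, this⟩
    · intro k hk
      simp only [Finset.mem_filter, Finset.mem_univ, true_and] at hk
      simp only [Finset.mem_filter, Finset.mem_biUnion, r, Finset.mem_univ, true_and]
      exact ⟨⟨i, hi.1, hk⟩, hk.1.trans hi.2⟩
  · intro k hk
    obtain ⟨i, hi, hk⟩ := Finset.mem_biUnion.mp (Finset.mem_coe.mp hk)
    simp only [r, Finset.mem_filter] at hk
    exact Finset.mem_coe.mpr (Finset.mem_image.mpr ⟨i, hi, hk.2.1.symm⟩)

lemma map_get_toList_univ (B : Multiset Bar) :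
    (Finset.univ : Finset (Fin B.toList.length)).val.map B.toList.get = B := by
  rw [Fin.univ_val_map, List.ofFn_get, Multiset.coe_toList]

/-- **Induced matching for surjections.** If there is a pointwise surjective morphism
`σ : M → N`, then there is an injective matching `m` of the whole multiset `C` into the
multiset `B` (recorded as a multiset of pairs) such that each bar `(b,e] ∈ C` is
matched to a bar `(b,d] ∈ B` with the same left endpoint and with `d ≥ e`. -/
theorem induced_matching_surjections {𝔽 : Type} [Field 𝔽]
    (M N : PersistenceModule 𝔽) (hM : M.IsRegular) (hN : N.IsRegular)
    (B C : Multiset Bar) (hB : ∀ I ∈ B, Bar.valid I) (hC : ∀ I ∈ C, Bar.valid I)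
    (hMB : PersistenceModule.Iso M (barcodeModule 𝔽 B))
    (hNC : PersistenceModule.Iso N (barcodeModule 𝔽 C))
    (σ : PersistenceModule.Hom M N) (hσ : ∀ t : ℝ, Function.Surjective (σ.A t)) :
    ∃ m : Multiset (Bar × Bar),
      m.map Prod.fst = C ∧ m.map Prod.snd ≤ B ∧
      ∀ p ∈ m, p.2.1 = p.1.1 ∧ p.1.2 ≤ p.2.2 := by
  obtain ⟨fM, gM, hM', -⟩ := hMB
  obtain ⟨fN, gN, -, hN'⟩ := hNC
  let τ : PersistenceModule.Hom (barcodeModule 𝔽 B) (barcodeModule 𝔽 C) :=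
    { A := fun t => (fN.A t).comp ((σ.A t).comp (gM.A t))
      comm := fun s t h => LinearMap.ext fun x => by
        have h₁ := LinearMap.congr_fun (gM.comm s t h) x
        have h₂ := LinearMap.congr_fun (σ.comm s t h) (gM.A s x)
        have h₃ := LinearMap.congr_fun (fN.comm s t h) (σ.A s (gM.A s x))
        simp only [LinearMap.comp_apply] at h₁ h₂ h₃ ⊢
        rw [h₁, h₂, h₃] }
  have hτ : ∀ t, Function.Surjective (τ.A t) := fun t =>
    (Function.LeftInverse.surjective (hN' t)).comp
      ((hσ t).comp (Function.LeftInverse.surjective (hM' t)))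
  obtain ⟨μ, hμ, hle⟩ := exists_injective_bar_matching C.toList.get B.toList.get fun j => by
    have hj : C.toList.get j ∈ C := Multiset.mem_toList.mp (List.get_mem _ j)
    obtain ⟨e, hbe, he⟩ := exists_real_threshold (B + C).toFinset (hC _ hj)
    obtain ⟨t, hbt, hte, hgap⟩ := exists_gap B.toFinset hbe
    have hcard := card_bars_le_of_surjective τ hτ hbt hte
      fun I hI => hgap I (Multiset.mem_toFinset.mpr hI)
    have hBe : ∀ i, (e : EReal) ≤ (B.toList.get i).2 ↔ (C.toList.get j).2 ≤ (B.toList.get i).2 :=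
      fun i => he _ (Multiset.mem_toFinset.mpr (Multiset.mem_add.mpr
        (Or.inl (Multiset.mem_toList.mp (List.get_mem _ i)))))
    have hCe : ∀ i, (e : EReal) ≤ (C.toList.get i).2 ↔ (C.toList.get j).2 ≤ (C.toList.get i).2 :=
      fun i => he _ (Multiset.mem_toFinset.mpr (Multiset.mem_add.mpr
        (Or.inr (Multiset.mem_toList.mp (List.get_mem _ i)))))
    simpa only [hBe, hCe] using hcard
  refine ⟨Finset.univ.val.map fun j => (C.toList.get j, B.toList.get (μ j)), ?_, ?_, ?_⟩
  · rw [Multiset.map_map]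
    exact map_get_toList_univ C
  · rw [Multiset.map_map]
    calc Finset.univ.val.map (fun j => B.toList.get (μ j))
        = (Finset.univ.map ⟨μ, hμ⟩).val.map B.toList.get := by
          rw [Finset.map_val, Multiset.map_map]; rfl
      _ ≤ Finset.univ.val.map B.toList.get :=
          Multiset.map_le_map (Finset.val_le_iff.mpr (Finset.subset_univ _))
      _ = B := map_get_toList_univ B
  · intro p hp
    obtain ⟨j, -, rfl⟩ := Multiset.mem_map.mp hp
    exact hle j
end

section
/- Let B and C be barcodes each containing exactly N infinite bars, with left endpoints (listed in nondecreasing order, with multiplicity) b_1 ≤ … ≤ b_N for B and c_1 ≤ … ≤ c_N for C. Then d_bot(B,C) ≥ max_{1≤i≤N} |b_i − c_i|. -/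
open Classical

lemma IsMatching.swap {δ : ℝ} {B C : Multiset Bar} {m : Multiset (Bar × Bar)}
    (h : IsMatching δ B C m) : IsMatching δ C B (m.map Prod.swap) := by
  obtain ⟨h₁, h₂, h₃, h₄, h₅⟩ := h
  refine ⟨by simpa [Multiset.map_map] using h₂, by simpa [Multiset.map_map] using h₁,
    by simpa [Multiset.map_map] using h₄, by simpa [Multiset.map_map] using h₃, ?_⟩
  intro p hp
  obtain ⟨q, hq, rfl⟩ := Multiset.mem_map.1 hp
  obtain ⟨hl, hr⟩ := h₅ q hq
  refine ⟨by simpa [abs_sub_comm] using hl, ?_⟩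
  rcases hr with ⟨h, h'⟩ | ⟨h, h', hd⟩
  · exact Or.inl ⟨h', h⟩
  · exact Or.inr ⟨h', h, by simpa [abs_sub_comm] using hd⟩

lemma barLong_of_snd_eq_top (δ : ℝ) {I : Bar} (h : I.2 = ⊤) : BarLong δ I := by
  rw [BarLong, h, EReal.top_sub_coe]
  exact EReal.coe_lt_top _

/-- A `δ`-matching maps the infinite bars of `B` starting at or before `t` injectively to
infinite bars of `C` starting at or before `t + δ`. -/
lemma IsMatching.countP_infinite_le {δ : ℝ} {B C : Multiset Bar} {m : Multiset (Bar × Bar)}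
    (h : IsMatching δ B C m) (t : ℝ) :
    B.countP (fun I : Bar => I.1 ≤ t ∧ I.2 = ⊤) ≤
      C.countP (fun I : Bar => I.1 ≤ t + δ ∧ I.2 = ⊤) := by
  obtain ⟨-, h₂, h₃, -, h₅⟩ := h
  calc B.countP (fun I : Bar => I.1 ≤ t ∧ I.2 = ⊤)
      = (cfilter (BarLong δ) B).countP (fun I : Bar => I.1 ≤ t ∧ I.2 = ⊤) := by
        rw [cfilter, Multiset.countP_filter]
        refine Multiset.countP_congr rfl fun I _ => ?_
        simpa using fun _ hI => barLong_of_snd_eq_top δ hI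
    _ ≤ (m.map Prod.fst).countP (fun I : Bar => I.1 ≤ t ∧ I.2 = ⊤) :=
        Multiset.countP_le_of_le _ h₃
    _ ≤ (m.map Prod.snd).countP (fun I : Bar => I.1 ≤ t + δ ∧ I.2 = ⊤) := by
        rw [Multiset.countP_map, Multiset.countP_map]
        refine Multiset.card_le_card (Multiset.le_filter.2
          ⟨Multiset.filter_le _ _, fun p hp => ?_⟩)
        obtain ⟨hp, hpt, hptop⟩ := Multiset.mem_filter.1 hp
        obtain ⟨hl, hr⟩ := h₅ p hp
        refine ⟨by linarith [(abs_le.1 hl).1], ?_⟩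
        rcases hr with h | h
        · exact h.2
        · exact absurd hptop h.1
    _ ≤ C.countP (fun I : Bar => I.1 ≤ t + δ ∧ I.2 = ⊤) := Multiset.countP_le_of_le _ h₂

lemma countP_infinite_eq_card {N : ℕ} {B : Multiset Bar} {b : Fin N → ℝ}
    (hB : cfilter (fun I : Bar => I.2 = ⊤) B
      = Multiset.map (fun i : Fin N => ((b i : ℝ), (⊤ : EReal))) Finset.univ.val) (t : ℝ) :
    B.countP (fun I : Bar => I.1 ≤ t ∧ I.2 = ⊤) =
      (Finset.univ.filter fun i => b i ≤ t).card := by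
  have h : B.countP (fun I : Bar => I.1 ≤ t ∧ I.2 = ⊤) =
      (cfilter (fun I : Bar => I.2 = ⊤) B).countP (fun I : Bar => I.1 ≤ t) := by
    rw [cfilter, Multiset.countP_filter]
    congr
  rw [h, hB, Multiset.countP_map]
  rfl

/-- If the infinite bars of `B` and `C` are listed in nondecreasing order, then a `δ`-matching
forces each left endpoint for `C` to exceed the corresponding one for `B` by at most `δ`. -/
lemma IsMatching.left_le_left_add {δ : ℝ} {N : ℕ} {B C : Multiset Bar}
    {m : Multiset (Bar × Bar)} (h : IsMatching δ B C m)
    {b c : Fin N → ℝ} (hb : Monotone b) (hc : Monotone c)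
    (hB : cfilter (fun I : Bar => I.2 = ⊤) B
      = Multiset.map (fun i : Fin N => ((b i : ℝ), (⊤ : EReal))) Finset.univ.val)
    (hC : cfilter (fun I : Bar => I.2 = ⊤) C
      = Multiset.map (fun i : Fin N => ((c i : ℝ), (⊤ : EReal))) Finset.univ.val)
    (i : Fin N) : c i ≤ b i + δ := by
  by_contra! hlt
  have hcount := h.countP_infinite_le (b i)
  rw [countP_infinite_eq_card hB, countP_infinite_eq_card hC] at hcount
  have hlow : (Finset.Iic i).card ≤ (Finset.univ.filter fun j => b j ≤ b i).card :=
    Finset.card_le_card fun j hj => by simpa using hb (Finset.mem_Iic.1 hj)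
  have hupp : (Finset.univ.filter fun j => c j ≤ b i + δ).card ≤ (Finset.Iio i).card := by
    refine Finset.card_le_card fun j hj => Finset.mem_Iio.2 ?_
    by_contra! hij
    linarith [(Finset.mem_filter.1 hj).2, hc hij]
  rw [Fin.card_Iic] at hlow
  rw [Fin.card_Iio] at hupp
  omega

/-- If the infinite bars of the barcodes `B` and `C` are exactly
`(b 1, +∞), …, (b N, +∞)` and `(c 1, +∞), …, (c N, +∞)` with `b` and `c` nondecreasing,
then `d_bot(B,C) ≥ max_i |b i − c i|`. -/
theorem infinite_bars_lower_bound (N : ℕ) (hN : 0 < N)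
    (B C : Multiset Bar) (hB : ∀ I ∈ B, Bar.valid I) (hC : ∀ I ∈ C, Bar.valid I)
    (b c : Fin N → ℝ) (hb : Monotone b) (hc : Monotone c)
    (hBinf : cfilter (fun I : Bar => I.2 = ⊤) B
      = Multiset.map (fun i : Fin N => ((b i : ℝ), (⊤ : EReal))) Finset.univ.val)
    (hCinf : cfilter (fun I : Bar => I.2 = ⊤) C
      = Multiset.map (fun i : Fin N => ((c i : ℝ), (⊤ : EReal))) Finset.univ.val) :
    (((⨆ i : Fin N, |b i - c i|) : ℝ) : EReal) ≤ dBot B C := by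
  refine le_sInf ?_
  rintro _ ⟨δ, -, rfl, m, hm⟩
  have : Nonempty (Fin N) := ⟨⟨0, hN⟩⟩
  refine EReal.coe_le_coe_iff.2 (ciSup_le fun i => abs_sub_le_iff.2 ⟨?_, ?_⟩)
  · linarith [hm.swap.left_le_left_add hc hb hCinf hBinf i]
  · linarith [hm.left_le_left_add hb hc hBinf hCinf i]
end

section
/- For every k ≥ 1, the function β_k assigning to a barcode the length of its k-th longest finite bar is 2-Lipschitz with respect to the bottleneck distance: if there exists a δ-matching between barcodes B and C, then |β_k(B) − β_k(C)| ≤ 2δ. Consequently |β_k(B) − β_k(C)| ≤ 2 d_bot(B,C). -/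
open Classical

/-- In a nonincreasing list, the entry of index `n` exceeds `r ≥ 0` if and only if more than
`n` entries do. -/
lemma List.lt_getD_iff_lt_countP {l : List ℝ} (hl : l.Pairwise (· ≥ ·)) {r : ℝ} (hr : 0 ≤ r)
    (n : ℕ) : r < l.getD n 0 ↔ n < l.countP (fun x => decide (r < x)) := by
  induction l generalizing n with
  | nil => simpa using hr
  | cons a l ih =>
    rw [List.pairwise_cons] at hl
    by_cases ha : r < a
    · cases n with
      | zero => simp [ha]
      | succ n => simpa [ha] using ih hl.2 n
    · have hle : ∀ x ∈ a :: l, x ≤ r := by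
        intro x hx
        rcases List.mem_cons.1 hx with rfl | hx
        · exact not_lt.1 ha
        · exact (hl.1 x hx).trans (not_lt.1 ha)
      have h0 : (a :: l).countP (fun x => decide (r < x)) = 0 := by
        rw [List.countP_eq_zero]
        intro x hx
        simpa using hle x hx
      rw [h0]
      refine iff_of_false (not_lt.2 ?_) (Nat.not_lt_zero n)
      rw [List.getD_eq_getElem?_getD]
      rcases h : (a :: l)[n]? with _ | x
      · simpa using hr
      · exact hle x (List.mem_of_getElem? h)

lemma cfilter_eq_filter {α : Type} (p : α → Prop) [DecidablePred p] (s : Multiset α) :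
    cfilter p s = s.filter p := by
  unfold cfilter
  congr

/-- A finite bar of length greater than `r`. -/
def FiniteBarLongerThan (r : ℝ) (I : Bar) : Prop := I.2 ≠ ⊤ ∧ r < EReal.toReal I.2 - I.1

/-- `β_k` exceeds `r ≥ 0` if and only if at least `k` finite bars are longer than `r`. -/
lemma lt_betak_iff {k : ℕ} (hk : 1 ≤ k) (B : Multiset Bar) {r : ℝ} (hr : 0 ≤ r) :
    r < betak k B ↔ k ≤ B.countP (FiniteBarLongerThan r) := by
  unfold betak
  set s := (cfilter (fun I : Bar => I.2 ≠ ⊤) B).map (fun I : Bar => EReal.toReal I.2 - I.1)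
    with hs
  have hcount : (s.sort (· ≤ ·)).reverse.countP (fun x => decide (r < x)) =
      B.countP (FiniteBarLongerThan r) := by
    rw [List.countP_reverse, ← Multiset.coe_countP, Multiset.sort_eq, hs, Multiset.countP_map,
      cfilter_eq_filter, Multiset.filter_filter, Multiset.countP_eq_card_filter]
    exact congrArg Multiset.card (Multiset.filter_congr fun I _ => and_comm)
  rw [List.lt_getD_iff_lt_countP (List.pairwise_reverse.2 (s.pairwise_sort (· ≤ ·))) hr, hcount]
  omega

lemma betak_nonneg (k : ℕ) {B : Multiset Bar} (hB : ∀ I ∈ B, Bar.valid I) : 0 ≤ betak k B := by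
  unfold betak
  rw [List.getD_eq_getElem?_getD]
  rcases h : (((cfilter (fun I : Bar => I.2 ≠ ⊤) B).map
      (fun I : Bar => EReal.toReal I.2 - I.1)).sort (· ≤ ·)).reverse[k - 1]? with _ | x
  · simp
  · have hx := List.mem_of_getElem? h
    rw [List.mem_reverse, Multiset.mem_sort, Multiset.mem_map] at hx
    obtain ⟨I, hI, rfl⟩ := hx
    rw [cfilter_eq_filter, Multiset.mem_filter] at hI
    obtain ⟨hIB, hI⟩ := hI
    have hle := EReal.toReal_le_toReal (hB I hIB).le (EReal.coe_ne_bot _) hI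
    simpa using hle

lemma FiniteBarLongerThan.barLong {r δ : ℝ} {I : Bar} (hI : FiniteBarLongerThan r I)
    (hv : Bar.valid I) (hr : 2 * δ ≤ r) : BarLong δ I := by
  obtain ⟨a, b⟩ := I
  obtain ⟨h, hlen⟩ := hI
  simp only [Bar.valid] at *
  lift b to ℝ using ⟨h, (bot_le.trans_lt hv).ne'⟩
  simp only [BarLong, EReal.toReal_coe] at *
  exact_mod_cast hr.trans_lt hlen

lemma FiniteBarLongerThan.of_barClose {r δ : ℝ} {I J : Bar} (hI : FiniteBarLongerThan r I)
    (h : BarClose δ I J) : FiniteBarLongerThan (r - 2 * δ) J := by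
  obtain ⟨hfin, hlen⟩ := hI
  obtain ⟨hl, ⟨h, -⟩ | ⟨-, hJ, hr⟩⟩ := h
  · exact absurd h hfin
  · refine ⟨hJ, ?_⟩
    linarith [(abs_le.1 hl).1, (abs_le.1 hr).2]

lemma BarClose.symm {δ : ℝ} {I J : Bar} (h : BarClose δ I J) : BarClose δ J I := by
  obtain ⟨hl, ⟨h₁, h₂⟩ | ⟨h₁, h₂, hr⟩⟩ := h
  · exact ⟨abs_sub_comm I.1 J.1 ▸ hl, Or.inl ⟨h₂, h₁⟩⟩
  · exact ⟨abs_sub_comm I.1 J.1 ▸ hl, Or.inr ⟨h₂, h₁, by rwa [abs_sub_comm]⟩⟩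

/-- A `δ`-matching injects the finite bars longer than `r ≥ 2δ` into those longer than
`r - 2δ`. -/
lemma IsMatching.countP_le {δ r : ℝ} {B C : Multiset Bar} {m : Multiset (Bar × Bar)}
    (h : IsMatching δ B C m) (hB : ∀ I ∈ B, Bar.valid I) (hr : 2 * δ ≤ r) :
    B.countP (FiniteBarLongerThan r) ≤ C.countP (FiniteBarLongerThan (r - 2 * δ)) := by
  obtain ⟨-, hC, hlong, -, hclose⟩ := h
  calc B.countP (FiniteBarLongerThan r)
      = (cfilter (BarLong δ) B).countP (FiniteBarLongerThan r) := by
        rw [cfilter, Multiset.countP_filter]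
        exact Multiset.countP_congr rfl fun I hI =>
          propext ⟨fun h => ⟨h, h.barLong (hB I hI) hr⟩, And.left⟩
    _ ≤ (m.map Prod.fst).countP (FiniteBarLongerThan r) := Multiset.countP_le_of_le _ hlong
    _ ≤ (m.map Prod.snd).countP (FiniteBarLongerThan (r - 2 * δ)) := by
        rw [Multiset.countP_map, Multiset.countP_map, Multiset.filter_congr fun p hp =>
          ⟨fun h => ⟨h, h.of_barClose (hclose p hp)⟩, And.left⟩]
        exact Multiset.card_le_card (Multiset.monotone_filter_right m fun _ h => h.2)
    _ ≤ C.countP (FiniteBarLongerThan (r - 2 * δ)) := Multiset.countP_le_of_le _ hC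

lemma IsMatching.betak_le {k : ℕ} (hk : 1 ≤ k) {δ : ℝ} (hδ : 0 ≤ δ) {B C : Multiset Bar}
    {m : Multiset (Bar × Bar)} (h : IsMatching δ B C m) (hB : ∀ I ∈ B, Bar.valid I)
    (hC : ∀ I ∈ C, Bar.valid I) : betak k B ≤ betak k C + 2 * δ := by
  have h0 := betak_nonneg k hC
  by_contra! hlt
  have hcount := ((lt_betak_iff hk B (by linarith)).1 hlt).trans
    (h.countP_le hB (by linarith))
  rw [add_sub_cancel_right, ← lt_betak_iff hk C h0] at hcount
  exact lt_irrefl _ hcount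

/-- The function `β_k` (length of the `k`-th longest finite bar) is `2`-Lipschitz with
respect to the bottleneck distance: a `δ`-matching between `B` and `C` forces
`|β_k(B) − β_k(C)| ≤ 2δ`, and consequently `|β_k(B) − β_k(C)| ≤ 2 d_bot(B,C)`. -/
theorem betak_lipschitz (k : ℕ) (hk : 1 ≤ k)
    (B C : Multiset Bar) (hB : ∀ I ∈ B, Bar.valid I) (hC : ∀ I ∈ C, Bar.valid I) :
    (∀ δ : ℝ, 0 < δ → (∃ m, IsMatching δ B C m) → |betak k B - betak k C| ≤ 2 * δ) ∧
    ((|betak k B - betak k C| : ℝ) : EReal) ≤ 2 * dBot B C := by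
  have key : ∀ δ : ℝ, 0 < δ → (∃ m, IsMatching δ B C m) → |betak k B - betak k C| ≤ 2 * δ := by
    rintro δ hδ ⟨m, hm⟩
    rw [abs_sub_le_iff]
    constructor
    · linarith [hm.betak_le hk hδ.le hB hC]
    · linarith [hm.swap.betak_le hk hδ.le hC hB]
  refine ⟨key, ?_⟩
  have hhalf : ((|betak k B - betak k C| / 2 : ℝ) : EReal) ≤ dBot B C := by
    refine le_sInf ?_
    rintro _ ⟨δ, hδ, rfl, hm⟩
    exact EReal.coe_le_coe_iff.2 (by linarith [key δ hδ hm])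
  calc ((|betak k B - betak k C| : ℝ) : EReal)
      = 2 * ((|betak k B - betak k C| / 2 : ℝ) : EReal) := by
        rw [show (2 : EReal) = ((2 : ℝ) : EReal) from rfl, ← EReal.coe_mul]
        congr 1
        ring
    _ ≤ 2 * dBot B C := mul_le_mul_of_nonneg_left hhalf (by norm_num)
end

section
/- For any two barcodes B and C and every k ∈ ℕ, |μ_k(B) − μ_k(C)| ≤ d_bot(B,C), where μ_k is the multiplicity function. -/
open Classical

lemma mem_cfilter {α : Type} {p : α → Prop} {s : Multiset α} {x : α} :
    x ∈ cfilter p s ↔ x ∈ s ∧ p x :=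
  @Multiset.mem_filter α p (Classical.decPred p) x s

lemma le_cfilter {α : Type} {p : α → Prop} {s t : Multiset α} :
    s ≤ cfilter p t ↔ s ≤ t ∧ ∀ x ∈ s, p x :=
  @Multiset.le_filter α p (Classical.decPred p) s t

lemma cfilter_le {α : Type} (p : α → Prop) (s : Multiset α) : cfilter p s ≤ s :=
  (le_cfilter.1 le_rfl).1

lemma cfilter_le_cfilter {α : Type} {p q : α → Prop} {s t : Multiset α} (hst : s ≤ t)
    (hpq : ∀ x ∈ s, p x → q x) : cfilter p s ≤ cfilter q t :=
  le_cfilter.2 ⟨(cfilter_le p s).trans hst, fun x hx =>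
    hpq x (mem_cfilter.1 hx).1 (mem_cfilter.1 hx).2⟩

lemma card_cfilter_map {α β : Type} (p : β → Prop) (f : α → β) (s : Multiset α) :
    (cfilter p (s.map f)).card = (cfilter (fun x => p (f x)) s).card := by
  unfold cfilter
  rw [Multiset.filter_map, Multiset.card_map]
  congr!

lemma dBot_comm (B C : Multiset Bar) : dBot B C = dBot C B := by
  unfold dBot
  congr 1
  ext x
  constructor <;> rintro ⟨δ, hδ, hx, m, hm⟩ <;> exact ⟨δ, hδ, hx, _, hm.swap⟩

lemma dBot_nonneg (B C : Multiset Bar) : 0 ≤ dBot B C := by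
  refine le_sInf ?_
  rintro x ⟨δ, hδ, rfl, -⟩
  exact_mod_cast hδ.le

lemma muk_nonneg (k : ℕ) (B : Multiset Bar) : 0 ≤ muk k B :=
  le_sSup (Set.mem_insert _ _)

/-- A bar containing an interval of length `> 2δ` is itself of length `> 2δ`. -/
lemma barLong_of_contains {δ a b : ℝ} {I : Bar} (hab : 2 * δ < b - a)
    (ha : I.1 ≤ a) (hb : (b : EReal) ≤ I.2) : BarLong δ I := by
  have h1 : ((2 * δ : ℝ) : EReal) < ((b - a : ℝ) : EReal) := by exact_mod_cast hab
  refine h1.trans_le ?_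
  rw [EReal.coe_sub]
  exact EReal.sub_le_sub hb (by exact_mod_cast ha)

/-- If a bar contains `(a, b]`, any valid bar `δ`-close to it contains `(a + δ, b - δ]`. -/
lemma BarClose.contains_shrink {δ a b : ℝ} {I J : Bar} (h : BarClose δ I J) (hJ : J.valid)
    (ha : I.1 ≤ a) (hb : (b : EReal) ≤ I.2) :
    J.1 ≤ a + δ ∧ ((b - δ : ℝ) : EReal) ≤ J.2 := by
  obtain ⟨hl, hr⟩ := h
  have hl' := abs_le.1 hl
  refine ⟨by linarith, ?_⟩
  rcases hr with ⟨-, hJt⟩ | ⟨hIt, hJt, hd⟩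
  · rw [hJt]; exact le_top
  · have hJb : J.2 ≠ ⊥ := ne_bot_of_gt hJ
    have hIb : I.2 ≠ ⊥ := ne_bot_of_le_ne_bot (EReal.coe_ne_bot b) hb
    have hd' := abs_le.1 hd
    rw [← EReal.coe_toReal hIt hIb, EReal.coe_le_coe_iff] at hb
    rw [← EReal.coe_toReal hJt hJb, EReal.coe_le_coe_iff]
    linarith

/-- The multiplicity of an interval does not decrease when the interval shrinks. -/
lemma multB_mono (B : Multiset Bar) {a b a' b' : ℝ} (ha : a ≤ a') (hb : b' ≤ b) :
    multB B a b ≤ multB B a' b' := by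
  refine Multiset.card_le_card (cfilter_le_cfilter le_rfl fun I _ hI => ?_)
  exact ⟨hI.1.trans ha, le_trans (by exact_mod_cast hb) hI.2⟩

/-- A `δ`-matching sends the bars containing an interval of length `> 2δ` to bars containing
its `δ`-shrinking. -/
lemma IsMatching.multB_le {δ : ℝ} {B C : Multiset Bar} {m : Multiset (Bar × Bar)}
    (h : IsMatching δ B C m) (hC : ∀ I ∈ C, Bar.valid I) {a b : ℝ} (hab : 2 * δ < b - a) :
    multB B a b ≤ multB C (a + δ) (b - δ) := by
  obtain ⟨-, hmC, hBl, -, hm⟩ := h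
  set P : Bar → Prop := fun I => I.1 ≤ a ∧ (b : EReal) ≤ I.2
  set Q : Bar → Prop := fun I => I.1 ≤ a + δ ∧ ((b - δ : ℝ) : EReal) ≤ I.2
  have hlong : cfilter P B ≤ cfilter P (m.map Prod.fst) :=
    le_cfilter.2 ⟨(cfilter_le_cfilter le_rfl fun I _ hI =>
      barLong_of_contains hab hI.1 hI.2).trans hBl, fun I hI => (mem_cfilter.1 hI).2⟩
  have hpairs : (cfilter (fun p : Bar × Bar => P p.1) m).card
      ≤ (cfilter (fun p : Bar × Bar => Q p.2) m).card := by
    refine Multiset.card_le_card (cfilter_le_cfilter le_rfl fun p hpm hpP => ?_)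
    exact (hm p hpm).contains_shrink
      (hC _ (Multiset.mem_of_le hmC (Multiset.mem_map_of_mem _ hpm))) hpP.1 hpP.2
  calc multB B a b ≤ (cfilter P (m.map Prod.fst)).card := Multiset.card_le_card hlong
    _ = (cfilter (fun p : Bar × Bar => P p.1) m).card := card_cfilter_map P _ m
    _ ≤ (cfilter (fun p : Bar × Bar => Q p.2) m).card := hpairs
    _ = (cfilter Q (m.map Prod.snd)).card := (card_cfilter_map Q _ m).symm
    _ ≤ multB C (a + δ) (b - δ) := Multiset.card_le_card
      (cfilter_le_cfilter hmC fun _ _ h => h)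

lemma IsMatching.muk_le {δ : ℝ} {B C : Multiset Bar} {m : Multiset (Bar × Bar)}
    (h : IsMatching δ B C m) (hδ : 0 < δ) (hB : ∀ I ∈ B, Bar.valid I)
    (hC : ∀ I ∈ C, Bar.valid I) (k : ℕ) : muk k B ≤ muk k C + δ := by
  have hδ' : (0 : EReal) ≤ δ := by exact_mod_cast hδ.le
  refine sSup_le ?_
  rintro x (rfl | ⟨c, hc, rfl, a, b, hab, h1, h2⟩)
  · exact add_nonneg (muk_nonneg k C) hδ'
  rcases le_or_gt c δ with hcδ | hcδ
  · calc (c : EReal) ≤ δ := by exact_mod_cast hcδ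
      _ = 0 + δ := (zero_add _).symm
      _ ≤ muk k C + δ := by gcongr; exact muk_nonneg k C
  · have hlow : k ≤ multB C (a + δ) (b - δ) :=
      h1.ge.trans (h.multB_le hC (by linarith))
    have hupp : multB C (a + δ + 2 * (c - δ)) (b - δ - 2 * (c - δ)) ≤ k := by
      have := h.swap.multB_le hB (a := a + δ + 2 * (c - δ)) (b := b - δ - 2 * (c - δ))
        (by linarith)
      rwa [show a + δ + 2 * (c - δ) + δ = a + 2 * c by ring,
        show b - δ - 2 * (c - δ) - δ = b - 2 * c by ring, h2] at this
    have hmono : multB C (a + δ) (b - δ)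
        ≤ multB C (a + δ + 2 * (c - δ)) (b - δ - 2 * (c - δ)) :=
      multB_mono C (by linarith) (by linarith)
    have hmem : ((c - δ : ℝ) : EReal) ≤ muk k C :=
      le_sSup (Or.inr ⟨c - δ, by linarith, rfl, a + δ, b - δ, by linarith,
        le_antisymm (hmono.trans hupp) hlow, le_antisymm hupp (hlow.trans hmono)⟩)
    calc (c : EReal) = ((c - δ : ℝ) : EReal) + δ := by rw [← EReal.coe_add, sub_add_cancel]
      _ ≤ muk k C + δ := by gcongr

lemma muk_le_add_dBot (k : ℕ) (B C : Multiset Bar)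
    (hB : ∀ I ∈ B, Bar.valid I) (hC : ∀ I ∈ C, Bar.valid I) :
    muk k B ≤ muk k C + dBot B C := by
  have hC0 : muk k C ≠ ⊥ := ne_bot_of_le_ne_bot EReal.zero_ne_bot (muk_nonneg k C)
  have hd0 : dBot B C ≠ ⊥ := ne_bot_of_le_ne_bot EReal.zero_ne_bot (dBot_nonneg B C)
  rw [add_comm, ← EReal.sub_le_iff_le_add (Or.inl hC0) (Or.inr hd0)]
  refine le_sInf ?_
  rintro x ⟨δ, hδ, rfl, m, hm⟩
  rw [EReal.sub_le_iff_le_add (Or.inl hC0) (Or.inr (EReal.coe_ne_bot δ)), add_comm]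
  exact hm.muk_le hδ hB hC k

/-- The multiplicity function is `1`-Lipschitz with respect to the bottleneck distance:
for all barcodes `B`, `C` and every `k`, `|μ_k(B) − μ_k(C)| ≤ d_bot(B,C)` (stated as the
two one-sided inequalities in `EReal`). -/
theorem muk_lipschitz (k : ℕ) (B C : Multiset Bar)
    (hB : ∀ I ∈ B, Bar.valid I) (hC : ∀ I ∈ C, Bar.valid I) :
    muk k B ≤ muk k C + dBot B C ∧ muk k C ≤ muk k B + dBot B C := by
  refine ⟨muk_le_add_dBot k B C hB hC, ?_⟩
  rw [dBot_comm]
  exact muk_le_add_dBot k C B hC hB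
end

section
/- Barannikov's normal form for upper-triangular differentials: Let 𝔽 be a field, N ∈ ℕ, and let d : 𝔽^N → 𝔽^N be a linear map whose matrix in the standard basis e_1,…,e_N is upper triangular and which satisfies d ∘ d = 0. Then there exist a basis f_1,…,f_N of 𝔽^N obtained by a triangular change of basis (i.e., f_i = Σ_{j≤i} a_{ij} e_j with a_{ii} ≠ 0 for every i), a subset I ⊆ {1,…,N}, and an injective map φ : I → {1,…,N} \ I with φ(i) < i for all i ∈ I, such that d f_i = 0 for every i ∉ I and d f_i = f_{φ(i)} for every i ∈ I. -/
/-- `i` is the largest index at which `v` does not vanish. -/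
def IsLeadIndex {𝔽 ι : Type*} [Zero 𝔽] [LT ι] (v : ι → 𝔽) (i : ι) : Prop :=
  v i ≠ 0 ∧ ∀ j, i < j → v j = 0

theorem exists_isLeadIndex {𝔽 ι : Type*} [Zero 𝔽] [Fintype ι] [LinearOrder ι] {v : ι → 𝔽}
    (hv : v ≠ 0) : ∃ i, IsLeadIndex v i := by
  classical
  obtain ⟨k, hk⟩ := Function.ne_iff.mp hv
  obtain ⟨i, hi⟩ := (Finset.univ.filter fun j => v j ≠ 0).exists_maximal ⟨k, by simpa using hk⟩
  refine ⟨i, by simpa using hi.prop, fun j hij => ?_⟩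
  by_contra hj
  exact hi.not_gt (by simpa using hj) hij

theorem isLeadIndex_single {𝔽 ι : Type*} [MulZeroOneClass 𝔽] [Nontrivial 𝔽] [LinearOrder ι]
    (i : ι) : IsLeadIndex (Pi.single i (1 : 𝔽)) i :=
  ⟨by simp, fun _ hij => Pi.single_eq_of_ne hij.ne' _⟩

theorem IsLeadIndex.sub_smul {𝔽 ι : Type*} [Ring 𝔽] [LinearOrder ι] {v w : ι → 𝔽} {i k : ι}
    (hv : IsLeadIndex v i) (hw : IsLeadIndex w k) (hki : k < i) (c : 𝔽) :
    IsLeadIndex (v - c • w) i := by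
  refine ⟨by simpa [hw.2 i hki] using hv.1, fun j hij => ?_⟩
  simp [hv.2 j hij, hw.2 j (hki.trans hij)]

theorem apply_eq_zero_of_upperTriangular {𝔽 ι : Type*} [CommSemiring 𝔽] [Fintype ι]
    [LinearOrder ι] {d : (ι → 𝔽) →ₗ[𝔽] (ι → 𝔽)}
    (htri : ∀ k j : ι, k < j → d (Pi.single k 1) j = 0) {v : ι → 𝔽} {i : ι}
    (hv : ∀ j, i < j → v j = 0) {j : ι} (hij : i < j) : d v j = 0 := by
  rw [LinearMap.pi_apply_eq_sum_univ d v, Finset.sum_apply]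
  refine Finset.sum_eq_zero fun k _ => ?_
  rcases lt_or_ge i k with hik | hki
  · simp [hv k hik]
  · have h := htri k j (hki.trans_lt hij)
    have hs : (fun l => if k = l then (1 : 𝔽) else 0) = Pi.single k 1 := by
      ext l
      simp [Pi.single_apply, eq_comm]
    rw [hs, Pi.smul_apply, h, smul_zero]

/-- Among the vectors with leading index `i`, none of which is a cycle, one can choose a vector
whose boundary has the smallest leading index. -/
theorem exists_minimal_boundary {𝔽 ι : Type*} [Field 𝔽] [Fintype ι] [LinearOrder ι]
    (d : (ι → 𝔽) →ₗ[𝔽] (ι → 𝔽)) {i : ι} (hi : ∀ v, IsLeadIndex v i → d v ≠ 0) :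
    ∃ (k : ι) (v : ι → 𝔽), IsLeadIndex v i ∧ IsLeadIndex (d v) k ∧
      ∀ w l, IsLeadIndex w i → IsLeadIndex (d w) l → k ≤ l := by
  obtain ⟨k₀, hk₀⟩ := exists_isLeadIndex (hi _ (isLeadIndex_single i))
  obtain ⟨k, ⟨v, hv, hk⟩, hmin⟩ := wellFounded_lt.has_min
    {k : ι | ∃ v, IsLeadIndex v i ∧ IsLeadIndex (d v) k} ⟨k₀, _, isLeadIndex_single i, hk₀⟩
  exact ⟨k, v, hv, hk, fun w l hw hl => not_lt.mp (hmin l ⟨w, hw, hl⟩)⟩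

/-- A vector whose boundary has minimal leading index `k` cannot share `k` with the boundary of a
vector of smaller leading index, as subtracting a multiple of the latter would lower `k`. -/
theorem not_isLeadIndex_of_minimal_boundary {𝔽 ι : Type*} [Field 𝔽] [Fintype ι] [LinearOrder ι]
    {d : (ι → 𝔽) →ₗ[𝔽] (ι → 𝔽)} {a b k : ι} {v w : ι → 𝔽}
    (hb : ∀ u, IsLeadIndex u b → d u ≠ 0) (hw : IsLeadIndex w b) (hwk : IsLeadIndex (d w) k)
    (hmin : ∀ u l, IsLeadIndex u b → IsLeadIndex (d u) l → k ≤ l)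
    (hab : a < b) (hv : IsLeadIndex v a) : ¬ IsLeadIndex (d v) k := by
  intro hvk
  have hu := hw.sub_smul hv hab (d w k / d v k)
  obtain ⟨l, hl⟩ := exists_isLeadIndex (hb _ hu)
  refine hl.1 ?_
  rcases (hmin _ l hu hl).eq_or_lt with rfl | hkl
  · simp [div_mul_cancel₀ _ hvk.1]
  · simp [hwk.2 l hkl, hvk.2 l hkl]


/-- **Barannikov's normal form for upper-triangular differentials.** If `d` is an
upper-triangular linear map on `𝔽^N` with `d ∘ d = 0`, then there is a triangular
change of basis `f` (lower-index combinations with nonzero diagonal coefficients),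
a subset `I ⊆ {1,…,N}` and an injective map `φ : I → {1,…,N} \ I` with `φ(i) < i`,
such that `d f_i = 0` for `i ∉ I` and `d f_i = f_{φ(i)}` for `i ∈ I`. -/
theorem barannikov_normal_form (𝔽 : Type) [Field 𝔽] (N : ℕ)
    (d : (Fin N → 𝔽) →ₗ[𝔽] (Fin N → 𝔽))
    (htri : ∀ k j : Fin N, k < j → d (Pi.single k 1) j = 0)
    (hd2 : d.comp d = 0) :
    ∃ (f : Fin N → (Fin N → 𝔽)) (I : Finset (Fin N)) (φ : Fin N → Fin N),
      (∀ i j : Fin N, i < j → f i j = 0) ∧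
      (∀ i : Fin N, f i i ≠ 0) ∧
      Set.InjOn φ ↑I ∧
      (∀ i ∈ I, φ i ∉ I) ∧
      (∀ i ∈ I, φ i < i) ∧
      (∀ i ∉ I, d (f i) = 0) ∧
      (∀ i ∈ I, d (f i) = f (φ i)) := by
  classical
  have hdd : ∀ v, d (d v) = 0 := fun v => LinearMap.congr_fun hd2 v
  let I : Finset (Fin N) := Finset.univ.filter fun i => ∀ v, IsLeadIndex v i → d v ≠ 0
  have hI : ∀ i, i ∈ I ↔ ∀ v, IsLeadIndex v i → d v ≠ 0 := fun i => by simp [I]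
  have hcycle : ∀ i, ∃ z, i ∉ I → IsLeadIndex z i ∧ d z = 0 := fun i => by
    by_cases hi : i ∈ I
    · exact ⟨0, fun h => absurd hi h⟩
    · rw [hI] at hi
      push Not at hi
      obtain ⟨z, hz⟩ := hi
      exact ⟨z, fun _ => hz⟩
  have hchain : ∀ i, ∃ (k : Fin N) (v : Fin N → 𝔽), i ∈ I → IsLeadIndex v i ∧
      IsLeadIndex (d v) k ∧ ∀ w l, IsLeadIndex w i → IsLeadIndex (d w) l → k ≤ l := fun i => by
    by_cases hi : i ∈ I
    · obtain ⟨k, v, h⟩ := exists_minimal_boundary d ((hI i).mp hi)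
      exact ⟨k, v, fun _ => h⟩
    · exact ⟨i, 0, fun h => absurd h hi⟩
  choose z hz using hcycle
  choose φ v hv using hchain
  have hφI : ∀ i ∈ I, φ i ∉ I := fun i hi hmem =>
    (hI _).mp hmem _ (hv i hi).2.1 (hdd _)
  have hφlt : ∀ i ∈ I, φ i < i := fun i hi => by
    refine lt_of_le_of_ne (not_lt.mp fun h => ?_) fun h => hφI i hi (h.symm ▸ hi)
    exact (hv i hi).2.1.1 (apply_eq_zero_of_upperTriangular htri (hv i hi).1.2 h)
  have hne : ∀ a ∈ I, ∀ b ∈ I, a < b → φ a ≠ φ b := fun a ha b hb hab h =>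
    not_isLeadIndex_of_minimal_boundary ((hI b).mp hb) (hv b hb).1 (hv b hb).2.1 (hv b hb).2.2
      hab (hv a ha).1 (h ▸ (hv a ha).2.1)
  have hinj : Set.InjOn φ ↑I := fun a ha b hb h => by
    rcases lt_trichotomy a b with hab | hab | hab
    · exact absurd h (hne a ha b hb hab)
    · exact hab
    · exact absurd h.symm (hne b hb a ha hab)
  let f : Fin N → Fin N → 𝔽 := fun k =>
    if k ∈ I then v k else if h : ∃ i ∈ I, φ i = k then d (v h.choose) else z k
  have hfI : ∀ i ∈ I, f i = v i := fun i hi => if_pos hi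
  have hfφ : ∀ i ∈ I, f (φ i) = d (v i) := fun i hi => by
    have h : ∃ j ∈ I, φ j = φ i := ⟨i, hi, rfl⟩
    simp only [f, if_neg (hφI i hi), dif_pos h]
    rw [hinj h.choose_spec.1 hi h.choose_spec.2]
  have hfz : ∀ k ∉ I, (¬ ∃ i ∈ I, φ i = k) → f k = z k := fun k hk h => by
    simp only [f, if_neg hk, dif_neg h]
  have hfcycle : ∀ k ∉ I, IsLeadIndex (f k) k ∧ d (f k) = 0 := fun k hk => by
    by_cases h : ∃ i ∈ I, φ i = k
    · obtain ⟨i, hi, rfl⟩ := h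
      rw [hfφ i hi]
      exact ⟨(hv i hi).2.1, hdd _⟩
    · rw [hfz k hk h]
      exact hz k hk
  have hlead : ∀ k, IsLeadIndex (f k) k := fun k => by
    by_cases hk : k ∈ I
    · rw [hfI k hk]
      exact (hv k hk).1
    · exact (hfcycle k hk).1
  exact ⟨f, I, φ, fun i => (hlead i).2, fun i => (hlead i).1, hinj, hφI, hφlt,
    fun i hi => (hfcycle i hi).2, fun i hi => by rw [hfI i hi, hfφ i hi]⟩
end
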